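/- arXiv:math/0308081 — 2 statements merged into one kernel-verified Lean document; each statement's English description precedes it below -/
import Mathlib

section
/- Let s : ℕ → ℕ be a sequence of alphabet sizes with s(n) ≥ 2 and s(n) → ∞ as n → ∞, and suppose there is a sequence r : ℕ → ℝ with r(n) → ∞ such that s(n) < n/(log n + log log n + r(n)) for all sufficiently large n. Then the proportion of Cantorian tableaux tends to zero: C(n, s(n)) / s(n)^{n²} → 0 as n → ∞. -/
open Filter

/-- The permanent of a finite tableau. -/
def TPerm {n : ℕ} {A : Type*} (T : Fin n → Fin n → A) : Set (Fin n → A) :=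
  {w | ∃ π : Equiv.Perm (Fin n), ∀ j, w j = T (π j) j}

/-- A tableau is Cantorian if no row-word belongs to its permanent. -/
def Cantorian {n : ℕ} {A : Type*} (T : Fin n → Fin n → A) : Prop :=
  Set.range (fun i => T i) ∩ TPerm T = ∅

/-- `C n s` is the number of Cantorian `n × n` tableaux over an `s`-letter
alphabet. -/
noncomputable def C (n s : ℕ) : ℕ :=
  Nat.card {T : Fin n → Fin n → Fin s // Cantorian T}

open Finset

lemma cb_mul {α β : Type*} [DecidableEq β] (S : Finset α) (f : α → Finset β) (c : ℝ)
    (h : ∀ a ∈ S, ((f a).card : ℝ) ≤ c) : ((S.biUnion f).card : ℝ) ≤ S.card * c := by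
  calc ((S.biUnion f).card : ℝ) ≤ ((∑ a ∈ S, (f a).card : ℕ) : ℝ) := by
        exact_mod_cast card_biUnion_le
    _ = ∑ a ∈ S, ((f a).card : ℝ) := by push_cast; rfl
    _ ≤ ∑ a ∈ S, c := sum_le_sum h
    _ = _ := by simp

lemma cb_sum {α β : Type*} [DecidableEq β] (S : Finset α) (f : α → Finset β) (c : α → ℝ)
    (h : ∀ a ∈ S, ((f a).card : ℝ) ≤ c a) : ((S.biUnion f).card : ℝ) ≤ ∑ a ∈ S, c a := by
  calc ((S.biUnion f).card : ℝ) ≤ ((∑ a ∈ S, (f a).card : ℕ) : ℝ) := by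
        exact_mod_cast card_biUnion_le
    _ = ∑ a ∈ S, ((f a).card : ℝ) := by push_cast; rfl
    _ ≤ ∑ a ∈ S, c a := sum_le_sum h

def EV {n s : ℕ} (i0 : Fin n) (M Z : Finset (Fin n × Fin n)) :
    Finset (Fin n → Fin n → Fin s) :=
  univ.filter fun T => (∀ c ∈ M, T c.1 c.2 = T i0 c.2) ∧ ∀ c ∈ Z, T c.1 c.2 ≠ T i0 c.2

lemma EV_card {n s : ℕ} (hs : 2 ≤ s) (i0 : Fin n) (M Z : Finset (Fin n × Fin n))
    (hMZ : Disjoint M Z) (hM : ∀ c ∈ M, c.1 ≠ i0) (hZ : ∀ c ∈ Z, c.1 ≠ i0) :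
    ((EV (s := s) i0 M Z).card : ℝ) ≤
      (s : ℝ) ^ (n ^ 2) * ((1 / (s : ℝ)) ^ M.card * (1 - 1 / (s : ℝ)) ^ Z.card) := by
  have hs0 : (s : ℝ) ≠ 0 := by positivity
  let S : (Fin n → Fin s) → Fin n → Fin n → Finset (Fin s) := fun w i j =>
    if i = i0 then {w j} else if (i, j) ∈ M then {w j} else
      if (i, j) ∈ Z then univ.erase (w j) else univ
  have hsub : EV (s := s) i0 M Z ⊆ (univ : Finset (Fin n → Fin s)).biUnion fun w =>
      Fintype.piFinset fun i => Fintype.piFinset fun j => S w i j := by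
    intro T hT
    simp only [EV, mem_filter, mem_univ, true_and] at hT
    simp only [mem_biUnion, mem_univ, true_and, Fintype.mem_piFinset]
    refine ⟨T i0, fun i j => ?_⟩
    simp only [S]
    split_ifs with h1 h2 h3
    · simp [h1]
    · simpa using hT.1 _ h2
    · simpa using hT.2 _ h3
    · simp
  have hcard : ∀ w ∈ (univ : Finset (Fin n → Fin s)),
      ((Fintype.piFinset fun i => Fintype.piFinset fun j => S w i j).card : ℝ) ≤
        (s : ℝ) ^ (n ^ 2) * ((1 / (s : ℝ)) ^ n * ((1 / (s : ℝ)) ^ M.card *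
          (1 - 1 / (s : ℝ)) ^ Z.card)) := by
    intro w _
    apply le_of_eq
    have h1 : ∀ i j, ((S w i j).card : ℝ) = s * ((if i = i0 then 1 / (s : ℝ) else 1) *
        ((if (i, j) ∈ M then 1 / (s : ℝ) else 1) *
        (if (i, j) ∈ Z then 1 - 1 / (s : ℝ) else 1))) := by
      intro i j
      simp only [S]
      by_cases h1 : i = i0
      · have a : (i, j) ∉ M := fun h => hM _ h h1
        have b : (i, j) ∉ Z := fun h => hZ _ h h1
        simp only [h1, if_true] at *
        simp [a, b, hs0]
      · by_cases h2 : (i, j) ∈ M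
        · have b : (i, j) ∉ Z := fun h => (Finset.disjoint_left.mp hMZ h2 h)
          simp [h1, h2, b, hs0]
        · by_cases h3 : (i, j) ∈ Z
          · simp only [h1, h2, h3, if_true, if_false, card_erase_of_mem (mem_univ _), card_univ,
              Fintype.card_fin]
            rw [Nat.cast_sub (by omega)]
            field_simp
            simp
          · simp [h1, h2, h3]
    rw [Fintype.card_piFinset]
    simp only [Fintype.card_piFinset]
    push_cast
    simp only [h1]
    rw [← Fintype.prod_prod_type' (f := fun i j => (s:ℝ) * ((if i = i0 then 1 / (s : ℝ) else 1) *
        ((if (i, j) ∈ M then 1 / (s : ℝ) else 1) *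
        (if (i, j) ∈ Z then 1 - 1 / (s : ℝ) else 1))))]
    simp only [prod_mul_distrib]
    congr 1
    · simp [sq]
    congr 1
    · rw [Fintype.prod_prod_type]
      simp [prod_ite_eq']
    congr 1
    · rw [prod_ite]; simp
    · rw [prod_ite]; simp
  calc ((EV (s := s) i0 M Z).card : ℝ) ≤ _ := by exact_mod_cast card_le_card hsub
    _ ≤ _ := cb_mul _ _ _ hcard
    _ = _ := by
      simp only [card_univ, Fintype.card_fun, Fintype.card_fin]
      push_cast
      rw [one_div, inv_pow (s:ℝ) n]
      field_simp

lemma hall_min {ι α : Type*} [DecidableEq ι] [DecidableEq α] (t : ι → Finset α) (B : Finset ι) :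
    (B.biUnion t).card < B.card → ∃ B' ⊆ B, (B'.biUnion t).card + 1 = B'.card := by
  induction B using Finset.induction_on with
  | empty => simp
  | insert a B ha ih =>
    intro h
    by_cases h' : (B.biUnion t).card < B.card
    · obtain ⟨B', h1, h2⟩ := ih h'
      exact ⟨B', h1.trans (subset_insert _ _), h2⟩
    · refine ⟨_, Subset.refl _, ?_⟩
      have : (B.biUnion t).card ≤ ((insert a B).biUnion t).card :=
        card_le_card (biUnion_subset_biUnion_of_subset_left _ (subset_insert _ _))
      rw [card_insert_of_notMem ha] at *
      omega

/-- rows matching in column j -/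
def rw' {n s : ℕ} (i0 : Fin n) (T : Fin n → Fin n → Fin s) (j : Fin n) : Finset (Fin n) :=
  univ.filter fun i => T i j = T i0 j
def cl' {n s : ℕ} (i0 : Fin n) (T : Fin n → Fin n → Fin s) (i : Fin n) : Finset (Fin n) :=
  univ.filter fun j => T i j = T i0 j

lemma cant_obs {n s : ℕ} (i0 : Fin n) (T : Fin n → Fin n → Fin s) (hT : Cantorian T) :
    (∃ A : Finset (Fin n), 2 * A.card ≤ n + 1 ∧ (A.biUnion (cl' i0 T)).card + 1 = A.card) ∨
    (∃ B : Finset (Fin n), 2 * B.card ≤ n + 1 ∧ (B.biUnion (rw' i0 T)).card + 1 = B.card) := by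
  have h1 : ¬ ∀ B : Finset (Fin n), B.card ≤ (B.biUnion (rw' i0 T)).card := by
    rw [Finset.all_card_le_biUnion_card_iff_exists_injective]
    rintro ⟨f, hf, hf2⟩
    have hb : Function.Bijective f := Finite.injective_iff_bijective.mp hf
    have : T i0 ∈ Set.range (fun i => T i) ∩ TPerm T := by
      refine ⟨⟨i0, rfl⟩, Equiv.ofBijective f hb, fun j => ?_⟩
      have := hf2 j
      simp [rw'] at this
      simp [this]
    rw [hT] at this
    exact this
  push Not at h1
  obtain ⟨B, hB⟩ := h1
  obtain ⟨B, -, hB⟩ := hall_min _ _ hB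
  by_cases hc : 2 * B.card ≤ n + 1
  · exact Or.inr ⟨B, hc, hB⟩
  · left
    set A := (B.biUnion (rw' i0 T))ᶜ with hA
    have hAc : A.card = n - (B.biUnion (rw' i0 T)).card := by simp [hA, card_compl]
    have hsub : A.biUnion (cl' i0 T) ⊆ Bᶜ := by
      intro j hj
      simp only [mem_biUnion, hA, mem_compl, rw', cl', mem_filter, mem_univ, true_and] at hj ⊢
      obtain ⟨i, hi, hij⟩ := hj
      exact fun hjB => hi ⟨j, hjB, hij⟩
    have := card_le_card hsub
    have hBn : B.card ≤ n := by simpa using card_le_univ B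
    rw [card_compl, Fintype.card_fin] at this
    obtain ⟨A', hA', hA''⟩ := hall_min (cl' i0 T) A (by omega)
    have := card_le_card hA'
    exact ⟨A', by omega, hA''⟩

noncomputable def tA (n s k : ℕ) : ℝ := (n.choose k : ℝ) * ((n.choose (k-1) : ℝ) *
  ((k : ℝ)^(k-1) * ((1 / (s:ℝ))^(k-1) * (1 - 1/(s:ℝ))^(k*(n-(k-1))))))
noncomputable def tB (n s k : ℕ) : ℝ := (n.choose k : ℝ) * (((n-1).choose (k-2) : ℝ) *
  ((k : ℝ)^(k-2) * ((1 / (s:ℝ))^(k-2) * (1 - 1/(s:ℝ))^(k*(n-(k-1))))))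

lemma cardF {n k m: ℕ} (i0 : Fin n) (A D : Finset (Fin n)) (hA : A.card = k) (hD : D.card = m) :
    (Fintype.piFinset fun d => if d ∈ D then A else {i0}).card = k ^ m := by
  rw [Fintype.card_piFinset, ← hA, ← hD]
  have : ∀ d, (if d ∈ D then A else {i0}).card = if d ∈ D then A.card else 1 := by
    intro d; split_ifs <;> simp
  simp only [this]
  rw [prod_ite]; simp

lemma countA {n s : ℕ} (hs : 2 ≤ s) (i0 : Fin n) :
    ((univ.filter fun T : Fin n → Fin n → Fin s => ∃ A : Finset (Fin n),
      2 * A.card ≤ n + 1 ∧ (A.biUnion (cl' i0 T)).card + 1 = A.card).card : ℝ) ≤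
    ∑ k ∈ (Icc 1 n).filter (fun k => 2 * k ≤ n + 1), (s:ℝ)^(n^2) * tA n s k := by
  have hsub : (univ.filter fun T : Fin n → Fin n → Fin s => ∃ A : Finset (Fin n),
      2 * A.card ≤ n + 1 ∧ (A.biUnion (cl' i0 T)).card + 1 = A.card) ⊆
    ((Icc 1 n).filter (fun k => 2 * k ≤ n + 1)).biUnion fun k =>
      (powersetCard k (univ.erase i0)).biUnion fun A => 
        (powersetCard (k-1) univ).biUnion fun D =>
          (Fintype.piFinset fun d => if d ∈ D then A else {i0}).biUnion fun f =>
            EV i0 (D.image fun d => (f d, d)) (A ×ˢ Dᶜ) := by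
    intro T hT
    simp only [mem_filter, mem_univ, true_and] at hT
    obtain ⟨A, hA1, hA2⟩ := hT
    have hAn : A.card ≤ n := by simpa using card_le_univ A
    have hi : i0 ∉ A := by
      intro h
      have : cl' i0 T i0 ⊆ A.biUnion (cl' i0 T) := subset_biUnion_of_mem _ h
      have := card_le_card this
      simp [cl'] at this
      have e : cl' i0 T i0 = univ := by simp [cl']
      omega
    set D := A.biUnion (cl' i0 T) with hD
    have hex : ∀ d, ∃ a, if d ∈ D then a ∈ A ∧ T a d = T i0 d else a = i0 := by
      intro d
      split_ifs with h
      · simpa [hD, cl'] using h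
      · exact ⟨_, rfl⟩
    choose f hf using hex
    simp only [mem_biUnion, mem_filter, mem_Icc, mem_powersetCard, Fintype.mem_piFinset]
    refine ⟨A.card, ⟨⟨by omega, hAn⟩, hA1⟩, A, ⟨?_, rfl⟩, D, ⟨subset_univ _, by omega⟩, f, ?_, ?_⟩
    · intro a ha; simp; rintro rfl; exact hi ha
    · intro d
      have := hf d
      split_ifs at this ⊢
      · exact this.1
      · simpa using this
    · simp only [EV, mem_filter, mem_univ, true_and, mem_image, mem_product, mem_compl]
      constructor
      · rintro c ⟨d, hd, rfl⟩
        have := hf d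
        rw [if_pos hd] at this
        exact this.2
      · rintro c ⟨h1, h2⟩ h3
        apply h2
        simp only [hD, mem_biUnion, cl', mem_filter, mem_univ, true_and]
        exact ⟨_, h1, h3⟩
  refine le_trans (by exact_mod_cast card_le_card hsub) (cb_sum _ _ _ ?_)
  intro k hk
  simp only [mem_filter, mem_Icc] at hk
  have hp : (0:ℝ) ≤ 1 - 1/(s:ℝ) := by
    have : (2:ℝ) ≤ s := by exact_mod_cast hs
    rw [sub_nonneg, div_le_one (by linarith)]; linarith
  have e : (s:ℝ)^(n^2) * tA n s k = (n.choose k : ℝ) * ((n.choose (k-1) : ℝ) * ((k : ℝ)^(k-1) * 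
    ((s:ℝ)^(n^2) * ((1 / (s:ℝ))^(k-1) * (1 - 1/(s:ℝ))^(k*(n-(k-1))))))) := by
    unfold tA; ring
  rw [e]
  refine le_trans (cb_mul _ _ ((n.choose (k-1) : ℝ) * ((k : ℝ)^(k-1) * 
    ((s:ℝ)^(n^2) * ((1 / (s:ℝ))^(k-1) * (1 - 1/(s:ℝ))^(k*(n-(k-1))))))) ?_) ?_
  · intro A hA
    rw [mem_powersetCard] at hA
    refine le_trans (cb_mul _ _ ((k : ℝ)^(k-1) * 
      ((s:ℝ)^(n^2) * ((1 / (s:ℝ))^(k-1) * (1 - 1/(s:ℝ))^(k*(n-(k-1)))))) ?_) ?_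
    · intro D hD
      rw [mem_powersetCard] at hD
      refine le_trans (cb_mul _ _  
        ((s:ℝ)^(n^2) * ((1 / (s:ℝ))^(k-1) * (1 - 1/(s:ℝ))^(k*(n-(k-1))))) ?_) ?_
      · intro f hf
        rw [Fintype.mem_piFinset] at hf
        have hf' : ∀ d ∈ D, f d ∈ A := by
          intro d hd
          have := hf d
          rwa [if_pos hd] at this
        have hA' : ∀ a ∈ A, a ≠ i0 := fun a ha => (mem_erase.mp (hA.1 ha)).1
        refine le_trans (EV_card hs i0 _ _ ?_ ?_ ?_) ?_
        · rw [Finset.disjoint_left]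
          intro c hc hc'
          simp only [mem_image, mem_product, mem_compl] at hc hc'
          obtain ⟨d, hd, rfl⟩ := hc
          exact hc'.2 hd
        · intro c hc
          simp only [mem_image] at hc
          obtain ⟨d, hd, rfl⟩ := hc
          exact hA' _ (hf' d hd)
        · intro c hc
          exact hA' _ (mem_product.mp hc).1
        · rw [card_image_of_injective _ (fun a b h => (Prod.mk.inj h).2), card_product, card_compl,
            hA.2, hD.2, Fintype.card_fin]
      · rw [cardF i0 A D hA.2 hD.2]; push_cast; rfl
    · rw [card_powersetCard, card_univ, Fintype.card_fin]
  · rw [card_powersetCard, card_erase_of_mem (mem_univ _), card_univ, Fintype.card_fin]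
    apply mul_le_mul_of_nonneg_right
    · exact_mod_cast Nat.choose_le_choose k (Nat.sub_le n 1)
    · positivity

lemma countB {n s : ℕ} (hs : 2 ≤ s) (i0 : Fin n) :
    ((univ.filter fun T : Fin n → Fin n → Fin s => ∃ A : Finset (Fin n),
      2 * A.card ≤ n + 1 ∧ (A.biUnion (rw' i0 T)).card + 1 = A.card).card : ℝ) ≤
    ∑ k ∈ (Icc 2 n).filter (fun k => 2 * k ≤ n + 1), (s:ℝ)^(n^2) * tB n s k := by
  have hsub : (univ.filter fun T : Fin n → Fin n → Fin s => ∃ A : Finset (Fin n),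
      2 * A.card ≤ n + 1 ∧ (A.biUnion (rw' i0 T)).card + 1 = A.card) ⊆
    ((Icc 2 n).filter (fun k => 2 * k ≤ n + 1)).biUnion fun k =>
      (powersetCard k univ).biUnion fun A => 
        (powersetCard (k-2) (univ.erase i0)).biUnion fun D =>
          (Fintype.piFinset fun d => if d ∈ D then A else {i0}).biUnion fun f =>
            EV i0 (D.image fun d => (d, f d)) ((insert i0 D)ᶜ ×ˢ A) := by
    intro T hT
    simp only [mem_filter, mem_univ, true_and] at hT
    obtain ⟨A, hA1, hA2⟩ := hT
    have hAn : A.card ≤ n := by simpa using card_le_univ A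
    have hne : A.Nonempty := by rw [← card_pos]; omega
    obtain ⟨a0, ha0⟩ := hne
    set D := A.biUnion (rw' i0 T) with hD
    have hi : i0 ∈ D := by
      simp only [hD, mem_biUnion, rw', mem_filter, mem_univ, true_and]
      exact ⟨a0, ha0, trivial⟩
    have hDp : 0 < D.card := card_pos.mpr ⟨_, hi⟩
    have hex : ∀ d, ∃ a, if d ∈ D.erase i0 then a ∈ A ∧ T d a = T i0 a else a = i0 := by
      intro d
      split_ifs with h
      · have := (mem_erase.mp h).2
        simpa [hD, rw'] using this
      · exact ⟨_, rfl⟩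
    choose f hf using hex
    simp only [mem_biUnion, mem_filter, mem_Icc, mem_powersetCard, Fintype.mem_piFinset]
    refine ⟨A.card, ⟨⟨by omega, hAn⟩, hA1⟩, A, ⟨subset_univ _, rfl⟩, D.erase i0,
      ⟨erase_subset_erase _ (subset_univ _), by rw [card_erase_of_mem hi]; omega⟩, f, ?_, ?_⟩
    · intro d
      have := hf d
      split_ifs at this ⊢
      · exact this.1
      · simpa using this
    · simp only [EV, mem_filter, mem_univ, true_and, mem_image, mem_product, mem_compl,
        insert_erase hi]
      constructor
      · rintro c ⟨d, hd, rfl⟩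
        have := hf d
        rw [if_pos hd] at this
        exact this.2
      · rintro c ⟨h1, h2⟩ h3
        apply h1
        simp only [hD, mem_biUnion, rw', mem_filter, mem_univ, true_and]
        exact ⟨_, h2, h3⟩
  refine le_trans (by exact_mod_cast card_le_card hsub) (cb_sum _ _ _ ?_)
  intro k hk
  simp only [mem_filter, mem_Icc] at hk
  have e : (s:ℝ)^(n^2) * tB n s k = (n.choose k : ℝ) * (((n-1).choose (k-2) : ℝ) * ((k : ℝ)^(k-2) * 
    ((s:ℝ)^(n^2) * ((1 / (s:ℝ))^(k-2) * (1 - 1/(s:ℝ))^(k*(n-(k-1))))))) := by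
    unfold tB; ring
  rw [e]
  refine le_trans (cb_mul _ _ (((n-1).choose (k-2) : ℝ) * ((k : ℝ)^(k-2) * 
    ((s:ℝ)^(n^2) * ((1 / (s:ℝ))^(k-2) * (1 - 1/(s:ℝ))^(k*(n-(k-1))))))) ?_) ?_
  · intro A hA
    rw [mem_powersetCard] at hA
    refine le_trans (cb_mul _ _ ((k : ℝ)^(k-2) * 
      ((s:ℝ)^(n^2) * ((1 / (s:ℝ))^(k-2) * (1 - 1/(s:ℝ))^(k*(n-(k-1)))))) ?_) ?_
    · intro D hD
      rw [mem_powersetCard] at hD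
      have hiD : i0 ∉ D := fun h => (mem_erase.mp (hD.1 h)).1 rfl
      refine le_trans (cb_mul _ _  
        ((s:ℝ)^(n^2) * ((1 / (s:ℝ))^(k-2) * (1 - 1/(s:ℝ))^(k*(n-(k-1))))) ?_) ?_
      · intro f hf
        refine le_trans (EV_card hs i0 _ _ ?_ ?_ ?_) ?_
        · rw [Finset.disjoint_left]
          intro c hc hc'
          simp only [mem_image, mem_product, mem_compl] at hc hc'
          obtain ⟨d, hd, rfl⟩ := hc
          exact hc'.1 (mem_insert_of_mem hd)
        · intro c hc
          simp only [mem_image] at hc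
          obtain ⟨d, hd, rfl⟩ := hc
          exact fun h => hiD (h ▸ hd)
        · intro c hc h
          have := (mem_product.mp hc).1
          rw [mem_compl, h] at this
          exact this (mem_insert_self _ _)
        · rw [card_image_of_injective _ (fun a b h => (Prod.mk.inj h).1), card_product, card_compl,
            card_insert_of_notMem hiD, hA.2, hD.2, Fintype.card_fin, mul_comm k,
            show k - 2 + 1 = k - 1 by omega]
      · rw [cardF i0 A D hA.2 hD.2]; push_cast; rfl
    · rw [card_powersetCard, card_erase_of_mem (mem_univ _), card_univ, Fintype.card_fin]
  · rw [card_powersetCard, card_univ, Fintype.card_fin]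

lemma tB_le_tA {n s k : ℕ} (hs : 2 ≤ s) (hsn : s ≤ n) (hk : 2 ≤ k) : tB n s k ≤ tA n s k := by
  have hp : (0:ℝ) ≤ 1 - 1/(s:ℝ) := by
    have : (2:ℝ) ≤ s := by exact_mod_cast hs
    rw [sub_nonneg, div_le_one (by linarith)]; linarith
  obtain ⟨m, rfl⟩ : ∃ m, n = m + 1 := ⟨n - 1, by omega⟩
  obtain ⟨l, rfl⟩ : ∃ l, k = l + 2 := ⟨k - 2, by omega⟩
  have key : (m.choose l : ℝ) ≤ (m+1).choose (l+1) * ((l+2) * (1/(s:ℝ))) := by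
    have h := Nat.add_one_mul_choose_eq m l
    have h' : ((m:ℝ)+1) * m.choose l = (m+1).choose (l+1) * (l+1) := by exact_mod_cast h
    have hsn' : (s:ℝ) ≤ m + 1 := by exact_mod_cast hsn
    have hs0 : (0:ℝ) < s := by positivity
    rw [mul_one_div, mul_div_assoc', le_div_iff₀ hs0]
    have h0 : (0:ℝ) ≤ m.choose l := by positivity
    have h1 : (0:ℝ) ≤ (m+1).choose (l+1) := by positivity
    nlinarith
  unfold tA tB
  simp only [Nat.add_sub_cancel, show l + 2 - 1 = l + 1 by omega]
  have : ((m+1).choose (l+1) : ℝ) * (((l+2:ℕ) : ℝ)^(l+1) * ((1 / (s:ℝ))^(l+1) * (1 - 1/(s:ℝ))^((l+2)*(m+1-(l+1)))))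
    = ((m+1).choose (l+1) * ((l+2) * (1/(s:ℝ)))) * (((l+2:ℕ) : ℝ)^l * ((1 / (s:ℝ))^l * (1 - 1/(s:ℝ))^((l+2)*(m+1-(l+1))))) := by
    push_cast
    ring
  rw [this]
  gcongr

lemma xexp_mono {x0 x c : ℝ} (h0 : 2 ≤ x0) (h : x0 ≤ x) (hc : 1/2 ≤ c) :
    x * Real.exp (-(x*c)) ≤ x0 * Real.exp (-(x0*c)) := by
  have h1 : x ≤ x0 * Real.exp ((x - x0)*c) := by
    have := Real.add_one_le_exp ((x-x0)*c)
    have h2 : (x - x0) * (1/2) ≤ (x-x0)*c := by gcongr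
    nlinarith
  calc x * Real.exp (-(x*c)) ≤ x0 * Real.exp ((x - x0)*c) * Real.exp (-(x*c)) := by gcongr
    _ = _ := by rw [mul_assoc, ← Real.exp_add]; ring_nf

lemma exp_lin {n k x0 : ℝ} (hn : 0 < n) (hk : 1 ≤ k) (hkn : 2 * k ≤ n + 1)
    (h : Real.exp (x0/2) ≤ n/2) : Real.exp (x0 * (k-1)/n) ≤ k := by
  have ht0 : 0 ≤ 2*(k-1)/n := by have : 0 ≤ k - 1 := by linarith
                                 positivity
  have ht1 : 2*(k-1)/n ≤ 1 := by rw [div_le_one hn]; linarith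
  have := convexOn_exp.2 (Set.mem_univ 0) (Set.mem_univ (x0/2)) (sub_nonneg.mpr ht1) ht0 (by ring)
  simp only [smul_eq_mul, mul_zero, zero_add, Real.exp_zero, mul_one] at this
  have e : 2*(k-1)/n * (x0/2) = x0*(k-1)/n := by ring
  rw [e] at this
  have h3 : 2*(k-1)/n * Real.exp (x0/2) ≤ 2*(k-1)/n * (n/2) := by gcongr
  have h4 : 2*(k-1)/n * (n/2) = k - 1 := by field_simp
  linarith

lemma tA_le {n s k : ℕ} (hs : 2 ≤ s) (hk : 1 ≤ k) (hkn : 2 * k ≤ n + 1) (x0 : ℝ) (hx0 : 2 ≤ x0)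
    (hx : x0 ≤ (n:ℝ)/s) (h : Real.exp (x0/2) ≤ (n:ℝ)/2) :
    tA n s k ≤ (Real.exp 2 * (n * (x0 * Real.exp (-x0)))) ^ k := by
  have hs0 : (0:ℝ) < s := by positivity
  have hn : (0:ℝ) < n := by have : 0 < n := by omega
                            exact_mod_cast this
  have hk0 : (0:ℝ) < k := by exact_mod_cast hk
  have hp : (0:ℝ) ≤ 1 - 1/(s:ℝ) := by
    have : (2:ℝ) ≤ s := by exact_mod_cast hs
    rw [sub_nonneg, div_le_one (by linarith)]; linarith
  set x := (n:ℝ)/s with hxdef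
  have hfac : ((k:ℝ)^k / (k.factorial : ℝ)) ≤ Real.exp k := Real.pow_div_factorial_le_exp k hk0.le k
  set c : ℝ := (n - (k-1))/n with hc
  have hkn' : (2:ℝ) * k ≤ n + 1 := by exact_mod_cast hkn
  have hc2 : 1/2 ≤ c := by rw [hc, le_div_iff₀ hn]; linarith
  have hz : (1 - 1/(s:ℝ))^(k*(n-(k-1))) ≤ Real.exp (-(x*c)) ^ k := by
    rw [mul_comm k, pow_mul]
    have h1 : 1 - 1/(s:ℝ) ≤ Real.exp (-(1/(s:ℝ))) := Real.one_sub_le_exp_neg _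
    have h2 : (1 - 1/(s:ℝ))^(n-(k-1)) ≤ Real.exp (-(x*c)) := by
      calc _ ≤ Real.exp (-(1/(s:ℝ))) ^ (n-(k-1)) := by gcongr
        _ = _ := by
          rw [← Real.exp_nat_mul, Nat.cast_sub (by omega), Nat.cast_sub hk, hc, hxdef]
          congr 1
          push_cast
          field_simp
    gcongr
  have hch : (n.choose k : ℝ) ≤ (n:ℝ)^k / k.factorial := Nat.choose_le_pow_div k n
  have hch' : (n.choose (k-1) : ℝ) ≤ (n:ℝ)^(k-1) / (k-1).factorial := Nat.choose_le_pow_div (k-1) n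
  have hb : Real.exp 2 * (n * (x * Real.exp (-(x*c)))) / k ≤
      Real.exp 2 * (n * (x0 * Real.exp (-x0))) := by
    have e1 := xexp_mono hx0 hx hc2
    have e2 := exp_lin hn (by exact_mod_cast hk : (1:ℝ) ≤ k) hkn' h
    have e3 : Real.exp (-(x0*c)) = Real.exp (-x0) * Real.exp (x0*(k-1)/n) := by
      rw [← Real.exp_add, hc]; congr 1; field_simp; ring
    rw [div_le_iff₀ hk0]
    calc Real.exp 2 * (n * (x * Real.exp (-(x*c)))) ≤ Real.exp 2 * (n * (x0 * Real.exp (-(x0*c)))) := by gcongr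
      _ = Real.exp 2 * (n * (x0 * (Real.exp (-x0) * Real.exp (x0*(k-1)/n)))) := by rw [e3]
      _ ≤ Real.exp 2 * (n * (x0 * (Real.exp (-x0) * k))) := by gcongr
      _ = _ := by ring
  have hx1 : 1 ≤ x := by linarith
  calc tA n s k ≤ ((n:ℝ)^k / k.factorial) * (((n:ℝ)^(k-1) / (k-1).factorial) *
        ((k : ℝ)^(k-1) * ((1 / (s:ℝ))^(k-1) * Real.exp (-(x*c)) ^ k))) := by
        unfold tA; gcongr
    _ = (((n:ℝ) * (x * Real.exp (-(x*c)))) / k)^k * (((k:ℝ)^k / (k.factorial : ℝ)) * ((k:ℝ)^k / (k.factorial : ℝ))) * (1/x) := by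
        obtain ⟨l, rfl⟩ : ∃ l, k = l + 1 := ⟨k - 1, by omega⟩
        rw [Nat.factorial_succ, hxdef]
        simp only [Nat.add_sub_cancel]
        push_cast at hk0 ⊢
        have : ((l.factorial : ℕ) : ℝ) ≠ 0 := by positivity
        simp only [div_pow, mul_pow, one_div, inv_pow, pow_succ]
        field_simp
    _ ≤ (((n:ℝ) * (x * Real.exp (-(x*c)))) / k)^k * (Real.exp k * Real.exp k) * 1 := by
        have : 1/x ≤ 1 := by rw [div_le_one (by linarith)]; exact hx1
        gcongr
    _ = (Real.exp 2 * (n * (x * Real.exp (-(x*c)))) / k)^k := by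
        have : Real.exp k * Real.exp k = Real.exp 2 ^ k := by
          rw [← Real.exp_add, ← Real.exp_nat_mul]; ring_nf
        rw [this, mul_one, ← mul_pow]; ring
    _ ≤ _ := by gcongr

lemma main_bound {n s : ℕ} (hs : 2 ≤ s) (x0 : ℝ) (hx0 : 2 ≤ x0)
    (hx : x0 ≤ (n:ℝ)/s) (h : Real.exp (x0/2) ≤ (n:ℝ)/2) (q : ℝ)
    (hq : Real.exp 2 * (n * (x0 * Real.exp (-x0))) ≤ q) (hq1 : q ≤ 1/2) :
    (C n s : ℝ) / (s:ℝ)^(n^2) ≤ 4 * q := by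
  classical
  have hs0 : (0:ℝ) < s := by positivity
  have hsn : s ≤ n := by
    have : (1:ℝ) ≤ n / s := by linarith
    rw [le_div_iff₀ hs0] at this
    have h2 : (s:ℝ) ≤ n := by linarith
    exact_mod_cast h2
  have hq0 : 0 ≤ q := le_trans (by positivity) hq
  have i0 : Fin n := ⟨0, by omega⟩
  have h1 : C n s ≤ (univ.filter fun T : Fin n → Fin n → Fin s => Cantorian T).card := by
    unfold C
    rw [Nat.card_eq_fintype_card, Fintype.card_subtype]
  have h2 : (univ.filter fun T : Fin n → Fin n → Fin s => Cantorian T) ⊆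
    (univ.filter fun T : Fin n → Fin n → Fin s => ∃ A : Finset (Fin n),
      2 * A.card ≤ n + 1 ∧ (A.biUnion (cl' i0 T)).card + 1 = A.card) ∪
    (univ.filter fun T : Fin n → Fin n → Fin s => ∃ A : Finset (Fin n),
      2 * A.card ≤ n + 1 ∧ (A.biUnion (rw' i0 T)).card + 1 = A.card) := by
    intro T hT
    simp only [mem_union, mem_filter, mem_univ, true_and] at hT ⊢
    exact cant_obs i0 T hT
  have h3 := (card_le_card h2).trans (card_union_le _ _)
  have h4 := (Nat.cast_le (α := ℝ)).mpr (h1.trans h3)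
  have hgeo : ∑ k ∈ Icc 1 n, q^k ≤ 2 * q := by
    have e : ∑ k ∈ Icc 1 n, q^k = q * ∑ k ∈ range n, q^k := by
      rw [mul_sum, ← Finset.Ico_add_one_right_eq_Icc, sum_Ico_eq_sum_range]
      simp [pow_add]
    have : ∑ k ∈ range n, q^k ≤ 2 := by
      have a : ∑ k ∈ range n, q^k ≤ ∑ k ∈ range n, (1/2:ℝ)^k := by gcongr
      have b := sum_geometric_two_le n
      linarith
    rw [e]; nlinarith
  have hAk : ∀ k, 1 ≤ k → 2 * k ≤ n + 1 → tA n s k ≤ q^k := fun k hk hk2 =>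
    (tA_le hs hk hk2 x0 hx0 hx h).trans (by gcongr)
  have hA : ∑ k ∈ (Icc 1 n).filter (fun k => 2 * k ≤ n + 1), (s:ℝ)^(n^2) * tA n s k ≤
      (s:ℝ)^(n^2) * (2*q) := by
    rw [← mul_sum]
    gcongr
    refine le_trans (sum_le_sum (g := fun k => q^k) ?_) (le_trans (sum_le_sum_of_subset_of_nonneg (t := Icc 1 n) ?_ ?_) hgeo)
    · intro k hk
      simp only [mem_filter, mem_Icc] at hk
      exact hAk k hk.1.1 hk.2
    · exact filter_subset _ _
    · intros; positivity
  have hB : ∑ k ∈ (Icc 2 n).filter (fun k => 2 * k ≤ n + 1), (s:ℝ)^(n^2) * tB n s k ≤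
      (s:ℝ)^(n^2) * (2*q) := by
    rw [← mul_sum]
    gcongr
    refine le_trans (sum_le_sum (g := fun k => q^k) ?_) (le_trans (sum_le_sum_of_subset_of_nonneg (t := Icc 1 n) ?_ ?_) hgeo)
    · intro k hk
      simp only [mem_filter, mem_Icc] at hk
      exact (tB_le_tA hs hsn hk.1.1).trans (hAk k (by omega) hk.2)
    · intro k hk
      simp only [mem_filter, mem_Icc] at hk ⊢
      omega
    · intros; positivity
  have := countA hs i0
  have := countB hs i0
  rw [div_le_iff₀ (by positivity)]
  push_cast at h4
  linarith

/-- If the alphabet size `s n ≥ 2` tends to infinity and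
`s n < n / (log n + log log n + r n)` eventually, where `r n → ∞`, then the
proportion of Cantorian `n × n` tableaux tends to `0`. -/
theorem proportion_cantorian_tendsto_zero (s : ℕ → ℕ) (hs2 : ∀ n, 2 ≤ s n)
    (hs : Tendsto s atTop atTop) (r : ℕ → ℝ) (hr : Tendsto r atTop atTop)
    (hbound : ∀ᶠ n : ℕ in atTop,
      (s n : ℝ) < n / (Real.log n + Real.log (Real.log n) + r n)) :
    Tendsto (fun n : ℕ => (C n (s n) : ℝ) / (s n : ℝ) ^ (n ^ 2)) atTop (nhds 0) := by
  have hlog : Tendsto (fun n : ℕ => Real.log (n:ℝ)) atTop atTop :=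
    Real.tendsto_log_atTop.comp tendsto_natCast_atTop_atTop
  have hll : Tendsto (fun n : ℕ => Real.log (Real.log (n:ℝ))) atTop atTop :=
    Real.tendsto_log_atTop.comp hlog
  set r0 : ℕ → ℝ := fun n => min (r n) (Real.log (Real.log (n:ℝ))) with hr0
  have hr0t : Tendsto r0 atTop atTop := tendsto_atTop_mono' (f₁ := r0) _ (Eventually.of_forall fun _ => le_rfl) (by
    rw [tendsto_atTop]
    intro b
    filter_upwards [hr.eventually_ge_atTop b, hll.eventually_ge_atTop b] with n h1 h2
    exact le_min h1 h2)
  set q : ℕ → ℝ := fun n => Real.exp 2 * 3 * Real.exp (-(r0 n)) with hqdef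
  have hqt : Tendsto q atTop (nhds 0) := by
    have := (Real.tendsto_exp_neg_atTop_nhds_zero.comp hr0t).const_mul (Real.exp 2 * 3)
    simpa using this
  have hq4 : Tendsto (fun n => 4 * q n) atTop (nhds 0) := by simpa using hqt.const_mul 4
  -- log² ≤ n/4
  have hsm : ∀ᶠ n : ℕ in atTop, Real.log (n:ℝ) ^ 2 ≤ (n:ℝ) / 4 := by
    have := (Real.isLittleO_pow_log_id_atTop (n := 2)).def (show (0:ℝ) < 1/4 by norm_num)
    have := tendsto_natCast_atTop_atTop.eventually this
    filter_upwards [this] with n hn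
    simp only [id, Real.norm_eq_abs, abs_pow, sq_abs, Nat.abs_cast] at hn
    linarith
  refine squeeze_zero' (Eventually.of_forall fun n => by positivity) ?_ hq4
  filter_upwards [hbound, hsm, hlog.eventually_ge_atTop 2, hll.eventually_ge_atTop 0,
    hr.eventually_ge_atTop 0, hr0t.eventually_ge_atTop 0, hqt.eventually_le_const (show (0:ℝ) < 1/2 by norm_num)]
    with n hb hsq hL hLL hrn hr0n hq1
  have hn : (0:ℝ) < n := by
    rcases Nat.eq_zero_or_pos n with rfl | h
    · simp at hL; linarith
    · exact_mod_cast h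
  set L := Real.log (n:ℝ) with hLdef
  have hLexp : Real.exp L = n := Real.exp_log hn
  have hLLexp : Real.exp (Real.log L) = L := Real.exp_log (by linarith)
  have hLLle : Real.log L ≤ L := (Real.log_le_sub_one_of_pos (by linarith)).trans (by linarith)
  have hr0r : r0 n ≤ r n := min_le_left _ _
  have hr0l : r0 n ≤ Real.log L := min_le_right _ _
  have hs0 : (0:ℝ) < s n := by have := hs2 n; positivity
  refine main_bound (hs2 n) (L + Real.log L + r0 n) (by linarith) ?_ ?_ (q n) ?_ hq1
  · rw [lt_div_iff₀ (by linarith)] at hb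
    rw [le_div_iff₀ hs0]
    nlinarith
  · have h1 : Real.exp ((L + Real.log L + r0 n)/2) ^ 2 ≤ ((n:ℝ)/2)^2 := by
      rw [← Real.exp_nat_mul]
      calc _ ≤ Real.exp (L + Real.log L + Real.log L) := by
            apply Real.exp_le_exp.mpr; push_cast; linarith
        _ = n * L^2 := by rw [Real.exp_add, Real.exp_add, hLexp, hLLexp]; ring
        _ ≤ n * (n/4) := by gcongr
        _ = _ := by ring
    exact (pow_le_pow_iff_left₀ (by positivity) (by positivity) two_ne_zero).mp h1
  · have : Real.exp (-(L + Real.log L + r0 n)) = (1/n) * (1/L) * Real.exp (-(r0 n)) := by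
      rw [neg_add, neg_add, Real.exp_add, Real.exp_add, Real.exp_neg L, Real.exp_neg (Real.log L), hLexp, hLLexp]
      simp
    rw [this]
    have hL0 : 0 < L := by linarith
    calc Real.exp 2 * (n * ((L + Real.log L + r0 n) * (1/n * (1/L) * Real.exp (-(r0 n)))))
        ≤ Real.exp 2 * (n * ((3*L) * (1/n * (1/L) * Real.exp (-(r0 n))))) := by
          gcongr; linarith
      _ = _ := by simp only [hqdef]; field_simp
end

section
/- Let ε > 0 and let s : ℕ → ℕ be a sequence of alphabet sizes with s(n) ≥ 2 and s(n) > n/(log n − log log n − ε) for all sufficiently large n. Then the proportion of Cantorian tableaux tends to one: C(n, s(n)) / s(n)^{n²} → 1 as n → ∞. -/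
open Filter

open Classical in
lemma card_bad_row (n s : ℕ) (i : Fin n) :
    (Finset.univ.filter (fun T : Fin n → Fin n → Fin s =>
      ∀ k, k ≠ i → ∃ j, T k j = T i j)).card
      ≤ s ^ n * (s ^ n - (s - 1) ^ n) ^ (n - 1) := by
  have hA : ∀ w : Fin n → Fin s,
      (Finset.univ.filter (fun u : Fin n → Fin s => ∃ j, u j = w j)).card
        = s ^ n - (s - 1) ^ n := by
    intro w
    have h1 : (Finset.univ.filter (fun u : Fin n → Fin s => ∃ j, u j = w j))
        = (Fintype.piFinset (fun j => ({w j}ᶜ : Finset (Fin s))))ᶜ := by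
      ext u
      simp [Fintype.mem_piFinset]
    rw [h1, Finset.card_compl, Fintype.card_piFinset]
    simp [Finset.card_compl]
  have hsub : (Finset.univ.filter (fun T : Fin n → Fin n → Fin s =>
      ∀ k, k ≠ i → ∃ j, T k j = T i j)) ⊆
      (Finset.univ : Finset (Fin n → Fin s)).biUnion (fun w =>
        Fintype.piFinset (fun k => if k = i then {w} else
          Finset.univ.filter (fun u : Fin n → Fin s => ∃ j, u j = w j))) := by
    intro T hT
    simp only [Finset.mem_filter, Finset.mem_univ, true_and] at hT
    simp only [Finset.mem_biUnion, Finset.mem_univ, true_and, Fintype.mem_piFinset]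
    refine ⟨T i, fun k => ?_⟩
    by_cases hk : k = i
    · simp [hk]
    · simpa [hk] using hT k hk
  refine (Finset.card_le_card hsub).trans (Finset.card_biUnion_le.trans ?_)
  have hB : ∀ w : Fin n → Fin s, (Fintype.piFinset (fun k : Fin n => if k = i then {w} else
          Finset.univ.filter (fun u : Fin n → Fin s => ∃ j, u j = w j))).card
          = (s ^ n - (s - 1) ^ n) ^ (n - 1) := by
    intro w
    rw [Fintype.card_piFinset, ← Finset.mul_prod_erase _ _ (Finset.mem_univ i)]
    rw [Finset.prod_congr rfl (g := fun _ => s ^ n - (s - 1) ^ n)]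
    · simp
    · intro k hk
      rw [if_neg (Finset.ne_of_mem_erase hk), hA w]
  simp only [hB]
  simp

open Classical in
lemma total_le (n s : ℕ) :
    (s ^ n) ^ n ≤ C n s + n * (s ^ n * (s ^ n - (s - 1) ^ n) ^ (n - 1)) := by
  have hC : C n s = (Finset.univ.filter
      (fun T : Fin n → Fin n → Fin s => Cantorian T)).card := by
    unfold C
    rw [Nat.card_eq_fintype_card, Fintype.card_subtype]
  have htot : (s ^ n) ^ n = (Finset.univ : Finset (Fin n → Fin n → Fin s)).card := by
    simp
  have hsub : (Finset.univ : Finset (Fin n → Fin n → Fin s)) ⊆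
      (Finset.univ.filter (fun T : Fin n → Fin n → Fin s => Cantorian T)) ∪
      (Finset.univ : Finset (Fin n)).biUnion (fun i =>
        Finset.univ.filter (fun T : Fin n → Fin n → Fin s =>
      ∀ k, k ≠ i → ∃ j, T k j = T i j)) := by
    intro T _
    by_cases hT : Cantorian T
    · simp [hT]
    · unfold Cantorian at hT
      obtain ⟨w, ⟨i, hi⟩, π, hπ⟩ := Set.nonempty_iff_ne_empty.mpr hT
      simp only [Finset.mem_union, Finset.mem_biUnion, Finset.mem_filter, Finset.mem_univ,
        true_and]
      refine Or.inr ⟨i, fun k _ => ⟨π.symm k, ?_⟩⟩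
      have := hπ (π.symm k)
      rw [Equiv.apply_symm_apply] at this
      rw [← this, ← hi]
  rw [htot, hC]
  refine (Finset.card_le_card hsub).trans ((Finset.card_union_le _ _).trans ?_)
  gcongr
  refine Finset.card_biUnion_le.trans ?_
  refine (Finset.sum_le_sum (fun i _ => card_bad_row n s i)).trans ?_
  simp

lemma C_le (n s : ℕ) : C n s ≤ (s ^ n) ^ n := by
  classical
  unfold C
  rw [Nat.card_eq_fintype_card]
  refine (Fintype.card_subtype_le _).trans ?_
  simp

lemma ratio_ge (n s : ℕ) (hn : 1 ≤ n) (hs : 2 ≤ s) :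
    1 - n * (1 - (1 - 1 / (s : ℝ)) ^ n) ^ (n - 1) ≤ (C n s : ℝ) / (s : ℝ) ^ (n ^ 2) := by
  have hs0 : (0 : ℝ) < s := by positivity
  have h := total_le n s
  have hle : (s - 1) ^ n ≤ s ^ n := Nat.pow_le_pow_left (Nat.sub_le _ _) _
  have h' : ((s : ℝ) ^ n) ^ n ≤
      C n s + n * ((s : ℝ) ^ n * ((s : ℝ) ^ n - ((s : ℝ) - 1) ^ n) ^ (n - 1)) := by
    have := (Nat.cast_le (α := ℝ)).mpr h
    push_cast [Nat.cast_sub hle, Nat.cast_sub (show 1 ≤ s by omega)] at this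
    exact this
  have e1 : (1 - 1 / (s : ℝ)) ^ n = ((s : ℝ) - 1) ^ n / (s : ℝ) ^ n := by
    rw [← div_pow]; congr 1; field_simp
  have e2 : (1 - (1 - 1 / (s : ℝ)) ^ n) ^ (n - 1)
      = ((s : ℝ) ^ n - ((s : ℝ) - 1) ^ n) ^ (n - 1) / ((s : ℝ) ^ n) ^ (n - 1) := by
    rw [e1, one_sub_div (by positivity), div_pow]
  have e3 : (s : ℝ) ^ (n ^ 2) = (s : ℝ) ^ n * ((s : ℝ) ^ n) ^ (n - 1) := by
    rw [← pow_succ', Nat.sub_add_cancel hn, ← pow_mul, sq]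
  have e4 : (s : ℝ) ^ (n ^ 2) = ((s : ℝ) ^ n) ^ n := by rw [← pow_mul, sq]
  rw [le_div_iff₀ (by positivity), e2]
  have e5 : (1 - (n : ℝ) * (((s : ℝ) ^ n - ((s : ℝ) - 1) ^ n) ^ (n - 1) / ((s : ℝ) ^ n) ^ (n - 1)))
      * (s : ℝ) ^ (n ^ 2) = (s : ℝ) ^ (n ^ 2) -
      n * ((s : ℝ) ^ n * ((s : ℝ) ^ n - ((s : ℝ) - 1) ^ n) ^ (n - 1)) := by
    rw [e3]; field_simp
  rw [e5, e4]
  linarith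

lemma key_bound (n s : ℕ) (hn : 1 ≤ n) (hs : 2 ≤ s) :
    1 - n * Real.exp (-((n - 1) * Real.exp (-(n / ((s : ℝ) - 1)))))
      ≤ (C n s : ℝ) / (s : ℝ) ^ (n ^ 2) := by
  refine le_trans ?_ (ratio_ge n s hn hs)
  have hs' : (2 : ℝ) ≤ s := by exact_mod_cast hs
  have hn' : (1 : ℝ) ≤ n := by exact_mod_cast hn
  have h1 : Real.exp (-(1 / ((s : ℝ) - 1))) ≤ 1 - 1 / (s : ℝ) := by
    have h2 := Real.add_one_le_exp (1 / ((s : ℝ) - 1))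
    have h3 : 1 / ((s : ℝ) - 1) + 1 = (1 - 1 / (s : ℝ))⁻¹ := by
      have : (s : ℝ) - 1 ≠ 0 := by linarith
      field_simp
      ring
    rw [h3] at h2
    rw [Real.exp_neg]
    have hp : 0 < 1 - 1 / (s : ℝ) := by
      have : 1 / (s : ℝ) < 1 := by rw [div_lt_one (by linarith)]; linarith
      linarith
    exact inv_le_of_inv_le₀ hp h2
  have h4 : Real.exp (-(n / ((s : ℝ) - 1))) ≤ (1 - 1 / (s : ℝ)) ^ n := by
    calc Real.exp (-(n / ((s : ℝ) - 1))) = Real.exp (-(1 / ((s : ℝ) - 1))) ^ n := by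
          rw [← Real.exp_nat_mul]; congr 1; ring
      _ ≤ _ := by gcongr
  have hle1 : (1 - 1 / (s : ℝ)) ^ n ≤ 1 := by
    apply pow_le_one₀
    · exact (Real.exp_pos _).le.trans h1
    · have : 0 ≤ 1 / (s : ℝ) := by positivity
      linarith
  have h5 : (1 - (1 - 1 / (s : ℝ)) ^ n) ^ (n - 1) ≤
      Real.exp (-((n - 1) * Real.exp (-(n / ((s : ℝ) - 1))))) := by
    calc (1 - (1 - 1 / (s : ℝ)) ^ n) ^ (n - 1)
        ≤ Real.exp (-Real.exp (-(n / ((s : ℝ) - 1)))) ^ (n - 1) := by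
          apply pow_le_pow_left₀ (by linarith)
          have := Real.add_one_le_exp (-Real.exp (-(n / ((s : ℝ) - 1))))
          linarith
      _ = _ := by
          rw [← Real.exp_nat_mul, Nat.cast_sub hn]; congr 1; push_cast; ring
  have := mul_le_mul_of_nonneg_left h5 (show (0 : ℝ) ≤ n by linarith)
  linarith

/-- If `ε > 0` and the alphabet size satisfies `s n ≥ 2` and
`s n > n / (log n - log log n - ε)` eventually, then the proportion of Cantorian
`n × n` tableaux tends to `1`. -/
theorem proportion_cantorian_tendsto_one (ε : ℝ) (hε : 0 < ε) (s : ℕ → ℕ)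
    (hs2 : ∀ n, 2 ≤ s n)
    (hbound : ∀ᶠ n : ℕ in atTop,
      (s n : ℝ) > n / (Real.log n - Real.log (Real.log n) - ε)) :
    Tendsto (fun n : ℕ => (C n (s n) : ℝ) / (s n : ℝ) ^ (n ^ 2)) atTop (nhds 1) := by
  have hcast : Tendsto (fun n : ℕ => (n : ℝ)) atTop atTop := tendsto_natCast_atTop_atTop
  have hlog : Tendsto (fun n : ℕ => Real.log n) atTop atTop :=
    Real.tendsto_log_atTop.comp hcast
  -- log log n + ε < log n eventually
  have hpos : ∀ᶠ n : ℕ in atTop, 0 < Real.log n - Real.log (Real.log n) - ε := by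
    have h1 : ∀ᶠ x : ℝ in atTop, Real.log x ≤ (1 / 2) * x := by
      have := Real.isLittleO_log_id_atTop.bound (show (0 : ℝ) < 1 / 2 by norm_num)
      filter_upwards [this, eventually_ge_atTop 0] with x hx hx0
      simp only [id, Real.norm_eq_abs, abs_of_nonneg hx0] at hx
      exact (le_abs_self _).trans hx
    filter_upwards [hlog.eventually h1, hlog.eventually_gt_atTop (2 * ε)] with n h2 h3
    linarith
  have hsmall : ∀ᶠ n : ℕ in atTop, 2 * (Real.log n ^ 2 / n) ≤ ε / 2 := by
    have h1 : Tendsto (fun x : ℝ => Real.log x ^ 2 / x) atTop (nhds 0) := by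
      have := (Real.isLittleO_pow_log_id_atTop (n := 2)).tendsto_div_nhds_zero
      simpa using this
    have h2 := (h1.comp hcast).eventually (eventually_le_nhds (show (0 : ℝ) < ε / 4 by linarith))
    filter_upwards [h2] with n hn
    simp only [Function.comp] at hn
    linarith
  have hlim : Tendsto (fun n : ℕ => 1 - Real.exp (-(ε / 4 * Real.log n))) atTop (nhds 1) := by
    have h1 : Tendsto (fun n : ℕ => Real.exp (-(ε / 4 * Real.log n))) atTop (nhds 0) :=
      Real.tendsto_exp_neg_atTop_nhds_zero.comp
        (hlog.const_mul_atTop (show (0 : ℝ) < ε / 4 by linarith))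
    simpa using h1.const_sub 1
  refine tendsto_of_tendsto_of_tendsto_of_le_of_le' hlim tendsto_const_nhds ?_ ?_
  · filter_upwards [hbound, hpos, hsmall, hlog.eventually_gt_atTop 1, eventually_ge_atTop 1,
      hcast.eventually_ge_atTop ((1 + ε / 2) / (ε / 4))] with n hb hp hsm hl hn hbig
    refine le_trans ?_ (key_bound n (s n) hn (hs2 n))
    have hs' : (2 : ℝ) ≤ s n := by exact_mod_cast hs2 n
    have hn0 : (0 : ℝ) < n := by exact_mod_cast hn
    have hll : 0 < Real.log (Real.log n) := Real.log_pos hl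
    set S : ℝ := (s n : ℝ) with hS
    set L := Real.log n - Real.log (Real.log n) - ε with hL
    have ht : n / S < L := by
      rw [gt_iff_lt, div_lt_iff₀ hp] at hb
      rw [div_lt_iff₀ (by linarith)]; linarith
    have ht0 : 0 < n / S := by positivity
    have ht2 : n / (S - 1) ≤ n / S + 2 * ((n / S) ^ 2 / n) := by
      have e : n / S + 2 * ((n / S) ^ 2 / n) = n * (S + 2) / S ^ 2 := by
        field_simp
      rw [e, div_le_div_iff₀ (by linarith) (by positivity)]
      nlinarith
    have ht3 : (n / S) ^ 2 / n ≤ Real.log n ^ 2 / n := by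
      gcongr
      linarith
    have ht4 : n / (S - 1) ≤ Real.log n - Real.log (Real.log n) - ε / 2 := by linarith
    have he : (1 + ε / 2) * (Real.log n / n) ≤ Real.exp (-(n / (S - 1))) := by
      calc (1 + ε / 2) * (Real.log n / n) ≤ Real.exp (ε / 2) * (Real.log n / n) := by
            have := Real.add_one_le_exp (ε / 2)
            gcongr
            linarith
        _ = Real.exp (-(Real.log n - Real.log (Real.log n) - ε / 2)) := by
            rw [show -(Real.log n - Real.log (Real.log n) - ε / 2)
              = ε / 2 + (Real.log (Real.log n) - Real.log n) by ring, Real.exp_add, Real.exp_sub,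
              Real.exp_log (by linarith), Real.exp_log hn0]
        _ ≤ _ := by gcongr
    have hn1 : (0 : ℝ) ≤ n - 1 := by
      have : (1 : ℝ) ≤ n := by exact_mod_cast hn
      linarith
    have hm : (1 + ε / 4) * Real.log n ≤ (n - 1) * Real.exp (-(n / (S - 1))) := by
      refine le_trans ?_ (mul_le_mul_of_nonneg_left he hn1)
      have e : ((n : ℝ) - 1) * ((1 + ε / 2) * (Real.log n / n))
          = ((n - 1) * (1 + ε / 2) / n) * Real.log n := by ring
      rw [e]
      gcongr
      rw [le_div_iff₀ hn0]
      rw [div_le_iff₀ (by linarith)] at hbig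
      nlinarith
    have hfin : n * Real.exp (-((n - 1) * Real.exp (-(n / (S - 1)))))
        ≤ Real.exp (-(ε / 4 * Real.log n)) := by
      calc n * Real.exp (-((n - 1) * Real.exp (-(n / (S - 1)))))
          ≤ n * Real.exp (-((1 + ε / 4) * Real.log n)) := by gcongr
        _ = Real.exp (Real.log n) * Real.exp (-((1 + ε / 4) * Real.log n)) := by
            rw [Real.exp_log hn0]
        _ = _ := by rw [← Real.exp_add]; congr 1; ring
    linarith
  · filter_upwards with n
    have hs0 : (0 : ℝ) < s n := by
      have := hs2 n
      exact_mod_cast (by omega : 0 < s n)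
    rw [div_le_one (by positivity), sq, pow_mul]
    exact_mod_cast C_le n (s n)
end
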